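/- For a tree T, let γ_T = limsup_{n→∞} (2/(|T|−2)) · ex_c(n,T)/n, where |T| is the number of vertices of T. For k ≥ 4 let γ_k be the infimum of γ_T over all trees T with at least k vertices, and let γ = lim_{k→∞} γ_k (this limit exists since γ_k is monotone increasing in k). Then 1/3 ≤ γ ≤ 2/3. -/

import Mathlib

open SimpleGraph

/-- `G` contains a copy of `F`, i.e. a subgraph isomorphic to `F`
(given by an injective graph homomorphism). -/
def ContainsCopy {α β : Type*} (F : SimpleGraph α) (G : SimpleGraph β) : Prop :=
  ∃ f : α ↪ β, ∀ ⦃a b : α⦄, F.Adj a b → G.Adj (f a) (f b)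

/-- The connected Turán number `ex_c(n, F)`: the maximum number of edges of a
connected `F`-free simple graph on `n` vertices. -/
noncomputable def exConn {α : Type*} (n : ℕ) (F : SimpleGraph α) : ℕ :=
  sSup {m | ∃ G : SimpleGraph (Fin n), G.Connected ∧ ¬ ContainsCopy F G ∧ m = G.edgeSet.ncard}

open Filter in
/-- `γ_T = limsup_{n → ∞} (2/(|T|-2)) ex_c(n,T)/n`. -/
noncomputable def gammaTree {V : Type*} [Fintype V] (T : SimpleGraph V) : ℝ :=
  limsup (fun n : ℕ => 2 / ((Fintype.card V : ℝ) - 2) * ((exConn n T : ℝ) / (n : ℝ))) atTop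

/-- `γ_k`: the infimum of `γ_T` over all trees `T` on at least `k` vertices. -/
noncomputable def gammaInf (k : ℕ) : ℝ :=
  sInf {x : ℝ | ∃ m : ℕ, k ≤ m ∧ ∃ T : SimpleGraph (Fin m), T.IsTree ∧ gammaTree T = x}


open Classical in
theorem core_aux {V : Type*} (G : SimpleGraph V) (d : ℕ) : ∀ (N : ℕ) (S : Finset V), S.card = N →
    2 * (d * S.card) < ∑ x ∈ S, (S.filter (fun y => G.Adj x y)).card →
    ∃ S' : Finset V, S'.Nonempty ∧ ∀ v ∈ S', d + 1 ≤ (S'.filter (fun y => G.Adj v y)).card := by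
  intro N
  induction N with
  | zero =>
    intro S hS h
    rw [Finset.card_eq_zero] at hS
    subst hS
    simp at h
  | succ N ih =>
    intro S hS h
    by_cases hall : ∀ v ∈ S, d + 1 ≤ (S.filter (fun y => G.Adj v y)).card
    · exact ⟨S, Finset.card_pos.mp (by omega), hall⟩
    · push Not at hall
      obtain ⟨v, hv, hlt⟩ := hall
      apply ih (S.erase v) (by rw [Finset.card_erase_of_mem hv]; omega)
      have h1 : ∑ x ∈ S, (S.filter (fun y => G.Adj x y)).card
          = (S.filter (fun y => G.Adj v y)).card
            + ∑ x ∈ S.erase v, (S.filter (fun y => G.Adj x y)).card :=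
        (Finset.add_sum_erase S _ hv).symm
      have h2 : ∀ x ∈ S.erase v, (S.filter (fun y => G.Adj x y)).card
          = ((S.erase v).filter (fun y => G.Adj x y)).card + if G.Adj v x then 1 else 0 := by
        intro x hx
        by_cases hvx : G.Adj v x
        · have : (S.erase v).filter (fun y => G.Adj x y)
              = (S.filter (fun y => G.Adj x y)).erase v := by
            rw [Finset.filter_erase]
          rw [this, if_pos hvx, Finset.card_erase_add_one]
          simp [hv, hvx.symm]
        · have : (S.erase v).filter (fun y => G.Adj x y)
              = (S.filter (fun y => G.Adj x y)) := by
            rw [Finset.filter_erase, Finset.erase_eq_of_notMem]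
            simp [G.adj_comm x v, hvx]
          rw [this, if_neg hvx, add_zero]
      have h3 : ∑ x ∈ S.erase v, (if G.Adj v x then 1 else 0)
          ≤ (S.filter (fun y => G.Adj v y)).card := by
        rw [← Finset.card_filter]
        exact Finset.card_le_card (Finset.filter_subset_filter _ (Finset.erase_subset _ _))
      rw [Finset.sum_congr rfl h2, Finset.sum_add_distrib] at h1
      rw [Finset.card_erase_of_mem hv, hS]
      rw [hS] at h
      have : 2 * (d * (N + 1)) = 2 * (d * N) + 2 * d := by ring
      simp only [Nat.add_sub_cancel]
      omega

open Classical in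
theorem two_mul_edges {V : Type*} [Fintype V] (G : SimpleGraph V) :
    ∑ v, (Finset.univ.filter (fun y => G.Adj v y)).card = 2 * G.edgeSet.ncard := by
  have := G.sum_degrees_eq_twice_card_edges
  rw [Set.ncard_eq_toFinset_card']
  rw [← SimpleGraph.edgeFinset, ← this]
  apply Finset.sum_congr rfl
  intro v _
  rw [← SimpleGraph.card_neighborFinset_eq_degree]
  congr 1
  ext y
  simp

open Classical in
theorem core_exists {V : Type*} [Fintype V] (G : SimpleGraph V) (d : ℕ)
    (h : d * Fintype.card V < G.edgeSet.ncard) :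
    ∃ S' : Finset V, S'.Nonempty ∧ ∀ v ∈ S', d + 1 ≤ (S'.filter (fun y => G.Adj v y)).card := by
  apply core_aux G d _ Finset.univ rfl
  rw [two_mul_edges, Finset.card_univ]
  omega

open Classical in
theorem long_path {V : Type*} (G : SimpleGraph V) (hG : G.Connected) (a : ℕ) (S : Finset V)
    (hne : S.Nonempty) (hS : ∀ v ∈ S, a + 1 ≤ (S.filter (fun y => G.Adj v y)).card) (w : V) :
    ∃ (v : V) (p : G.Walk w v), p.IsPath ∧ a ≤ p.length := by
  have key : ∀ d j, j + d = a → ∀ s ∈ S, ∀ p : G.Walk w s, p.IsPath → p.length = j →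
      ∃ (v : V) (p : G.Walk w v), p.IsPath ∧ a ≤ p.length := by
    intro d
    induction d with
    | zero => intro j hj s hs p hp hl; exact ⟨s, p, hp, by omega⟩
    | succ d ih =>
      intro j hj s hs p hp hl
      have hc : p.support.toFinset.card < (S.filter (fun y => G.Adj s y)).card := by
        have h1 := p.support.toFinset_card_le
        rw [SimpleGraph.Walk.length_support] at h1
        have := hS s hs
        omega
      obtain ⟨y, hy, hny⟩ := Finset.exists_mem_notMem_of_card_lt_card hc
      rw [Finset.mem_filter] at hy
      rw [List.mem_toFinset] at hny
      exact ih (j+1) (by omega) y hy.1 (p.concat hy.2) (hp.concat hny hy.2) (by simp [hl])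
  obtain ⟨s, hs⟩ := hne
  obtain ⟨p, hp⟩ := hG.exists_isPath w s
  by_cases h : a ≤ p.length
  · exact ⟨s, p, hp, h⟩
  · exact key (a - p.length) p.length (by omega) s hs p hp rfl

/-- parent function of the broom -/
def bpar (a i : ℕ) : ℕ := if i ≤ a then i - 1 else 0

/-- The broom: a path with `a` edges and `2 * a` leaves. -/
def broom (a : ℕ) : SimpleGraph (Fin (3 * a + 1)) :=
  SimpleGraph.fromRel (fun i j => i.val ≠ 0 ∧ j.val = bpar a i.val)

theorem broom_adj {a : ℕ} {i j : Fin (3*a+1)} : (broom a).Adj i j ↔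
    i ≠ j ∧ ((i.val ≠ 0 ∧ j.val = bpar a i.val) ∨ (j.val ≠ 0 ∧ i.val = bpar a j.val)) :=
  SimpleGraph.fromRel_adj _ _ _

theorem bpar_lt {a i : ℕ} (h : i ≠ 0) : bpar a i < i := by
  unfold bpar; split_ifs <;> omega

theorem broom_isTree (a : ℕ) : (broom a).IsTree := by
  have hc : (broom a).Connected := by
    have key : ∀ n, ∀ i : Fin (3*a+1), i.val = n → (broom a).Reachable i 0 := by
      intro n
      induction n using Nat.strong_induction_on with
      | _ n ih =>
        intro i hi
        by_cases h0 : i.val = 0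
        · have : i = 0 := Fin.ext h0
          rw [this]
        · have hlt := bpar_lt (a := a) h0
          have h1 : (broom a).Adj i ⟨bpar a i.val, by omega⟩ := by
            rw [broom_adj]
            refine ⟨?_, Or.inl ⟨h0, rfl⟩⟩
            intro h
            have := congrArg Fin.val h
            simp at this
            omega
          exact h1.reachable.trans (ih _ (hi ▸ hlt) _ rfl)
    rw [SimpleGraph.connected_iff]
    exact ⟨fun i j => (key _ i rfl).trans (key _ j rfl).symm, ⟨0⟩⟩
  rw [SimpleGraph.isTree_iff_connected_and_card]
  refine ⟨hc, le_antisymm ?_ hc.card_vert_le_card_edgeSet_add_one⟩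
  have hsub : (broom a).edgeSet ⊆ (fun i : Fin (3*a+1) =>
      s(i, (⟨bpar a i.val % (3*a+1), Nat.mod_lt _ (by omega)⟩ : Fin (3*a+1)))) '' {i | i ≠ 0} := by
    intro e
    induction e with
    | _ x y =>
      rw [SimpleGraph.mem_edgeSet, broom_adj]
      rintro ⟨_, h | h⟩
      · refine ⟨x, fun h0 => h.1 (by simp [h0]), ?_⟩
        have : (⟨bpar a x.val % (3*a+1), Nat.mod_lt _ (by omega)⟩ : Fin (3*a+1)) = y := by
          apply Fin.ext
          simp only [← h.2]
          exact Nat.mod_eq_of_lt y.2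
        simp only [this]
      · refine ⟨y, fun h0 => h.1 (by simp [h0]), ?_⟩
        have : (⟨bpar a y.val % (3*a+1), Nat.mod_lt _ (by omega)⟩ : Fin (3*a+1)) = x := by
          apply Fin.ext
          simp only [← h.2]
          exact Nat.mod_eq_of_lt x.2
        simp only [this, Sym2.eq_swap]
  have h1 := Set.ncard_le_ncard hsub
  have h2 := Set.ncard_image_le (f := (fun i : Fin (3*a+1) =>
      s(i, (⟨bpar a i.val % (3*a+1), Nat.mod_lt _ (by omega)⟩ : Fin (3*a+1)))))
      (s := {i | i ≠ 0}) (Set.toFinite _)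
  have h3 : ({i | i ≠ 0} : Set (Fin (3*a+1))).ncard = 3 * a := by
    have : ({i | i ≠ 0} : Set (Fin (3*a+1))) = {0}ᶜ := rfl
    rw [this, Set.ncard_compl]
    simp
  rw [Nat.card_coe_set_eq, Nat.card_eq_fintype_card, Fintype.card_fin]
  omega

theorem broom_embed {V : Type*} (G : SimpleGraph V) (a : ℕ) {w v : V} (p : G.Walk w v)
    (hp : p.IsPath) (hl : a ≤ p.length) (L : Finset V) (hL : 2 * a ≤ L.card)
    (hadj : ∀ u ∈ L, G.Adj w u) (hav : ∀ u ∈ L, ∀ i ≤ a, p.getVert i ≠ u) :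
    ContainsCopy (broom a) G := by
  classical
  let e := L.equivFin.symm
  have hinj := hp.getVert_injOn
  let f : Fin (3*a+1) → V := fun i => if h : i.val ≤ a then p.getVert i.val
    else (e ⟨i.val - a - 1, by omega⟩ : V)
  have hf1 : ∀ i : Fin (3*a+1), i.val ≤ a → f i = p.getVert i.val := fun i h => dif_pos h
  have hf2 : ∀ i : Fin (3*a+1), ¬ i.val ≤ a → f i ∈ L := fun i h => by
    simp only [f, dif_neg h]; exact (e _).2
  have hfi : Function.Injective f := by
    intro i j hij
    by_cases hi : i.val ≤ a <;> by_cases hj : j.val ≤ a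
    · rw [hf1 i hi, hf1 j hj] at hij
      exact Fin.ext (hinj (by simp; omega) (by simp; omega) hij)
    · exact absurd (by rw [← hf1 i hi, hij]) (hav _ (hf2 j hj) i.val hi)
    · exact absurd (by rw [← hf1 j hj, hij]) (hav _ (hf2 i hi) j.val hj)
    · simp only [f, dif_neg hi, dif_neg hj] at hij
      have := e.injective (Subtype.ext hij)
      simp at this
      apply Fin.ext
      omega
  have hdir : ∀ i j : Fin (3*a+1), i.val ≠ 0 → j.val = bpar a i.val → G.Adj (f i) (f j) := by
    intro i j hi hj
    unfold bpar at hj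
    split_ifs at hj with h
    · rw [hf1 i h, hf1 j (by omega)]
      have := p.adj_getVert_succ (i := j.val) (by omega)
      rw [show j.val + 1 = i.val by omega] at this
      exact this.symm
    · rw [hf1 j (by omega), hj, SimpleGraph.Walk.getVert_zero]
      exact (hadj _ (hf2 i h)).symm
  refine ⟨⟨f, hfi⟩, fun i j hij => ?_⟩
  rw [broom_adj] at hij
  rcases hij.2 with h | h
  · exact hdir i j h.1 h.2
  · exact (hdir j i h.1 h.2).symm

open Classical in
theorem ball_bound {V : Type*} [Fintype V] (G : SimpleGraph V) (D : ℕ)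
    (hD : ∀ v, (Finset.univ.filter (fun y => G.Adj v y)).card ≤ D) (v : V) (r : ℕ)
    (h : ∀ u, ∃ p : G.Walk u v, p.length ≤ r) : Fintype.card V ≤ (D + 1) ^ r := by
  have key : ∀ r, ∃ B : Finset V, B.card ≤ (D+1)^r ∧ ∀ u, ∀ p : G.Walk u v, p.length ≤ r → u ∈ B := by
    intro r
    induction r with
    | zero =>
      refine ⟨{v}, by simp, fun u p hp => ?_⟩
      have := SimpleGraph.Walk.eq_of_length_eq_zero (p := p) (by omega)
      simp [this]
    | succ r ih =>
      obtain ⟨B, hB, hB'⟩ := ih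
      refine ⟨B.biUnion (fun u => insert u (Finset.univ.filter (fun y => G.Adj u y))), ?_, ?_⟩
      · refine (Finset.card_biUnion_le_card_mul _ _ (D+1) ?_).trans ?_
        · intro u _
          exact (Finset.card_insert_le _ _).trans (by have := hD u; omega)
        · rw [pow_succ]; exact Nat.mul_le_mul_right _ hB
      · intro u p hp
        rw [Finset.mem_biUnion]
        cases p with
        | nil => exact ⟨_, hB' _ SimpleGraph.Walk.nil (by simp), by simp⟩
        | cons hadj q =>
          rw [SimpleGraph.Walk.length_cons] at hp
          exact ⟨_, hB' _ q (by omega), by simp [hadj.symm]⟩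
  obtain ⟨B, hB, hB'⟩ := key r
  rw [← Finset.card_univ]
  refine le_trans (Finset.card_le_card ?_) hB
  intro u _
  obtain ⟨p, hp⟩ := h u
  exact hB' u p hp

open Classical in
theorem broom_upper {V : Type*} [Fintype V] (G : SimpleGraph V) (hG : G.Connected) (a : ℕ)
    (hn : (3 * a + 1) ^ a < Fintype.card V) (hfree : ¬ ContainsCopy (broom a) G) :
    G.edgeSet.ncard ≤ a * Fintype.card V := by
  by_contra hlt
  push Not at hlt
  apply hfree
  have hdeg : ∃ v, 2 * a + 1 ≤ (Finset.univ.filter (fun y => G.Adj v y)).card := by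
    by_contra hno
    push Not at hno
    have h1 := two_mul_edges G
    have h2 : ∑ v, (Finset.univ.filter (fun y => G.Adj v y)).card ≤ ∑ v : V, 2 * a :=
      Finset.sum_le_sum (fun v _ => by have := hno v; omega)
    rw [Finset.sum_const, Finset.card_univ, smul_eq_mul] at h2
    nlinarith
  obtain ⟨v, hv⟩ := hdeg
  by_cases hfar : ∃ u, a ≤ G.dist v u
  · obtain ⟨u, hu⟩ := hfar
    obtain ⟨p, hp, hpl⟩ := hG.exists_path_of_dist v u
    refine broom_embed G a p hp (by omega)
      ((Finset.univ.filter (fun y => G.Adj v y)).erase (p.getVert 1)) ?_ ?_ ?_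
    · have := Finset.pred_card_le_card_erase
        (s := Finset.univ.filter (fun y => G.Adj v y)) (a := p.getVert 1)
      omega
    · intro x hx
      simp at hx
      exact hx.2
    · intro x hx i hi hix
      simp at hx
      have h0 : i ≠ 0 := by
        rintro rfl
        rw [SimpleGraph.Walk.getVert_zero] at hix
        exact hx.2.ne hix
      have h1 : i ≠ 1 := by rintro rfl; exact hx.1 hix.symm
      have hadj : G.Adj v (p.getVert i) := by rw [hix]; exact hx.2
      have := G.dist_le (SimpleGraph.Walk.cons hadj (p.drop i))
      simp at this
      omega
  · push Not at hfar
    have hbig : ∃ w, 3 * a + 1 ≤ (Finset.univ.filter (fun y => G.Adj w y)).card := by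
      by_contra hno
      push Not at hno
      have := ball_bound G (3*a) (fun v => by have := hno v; omega) v a (fun u => by
        obtain ⟨p, hp⟩ := hG.exists_walk_length_eq_dist u v
        refine ⟨p, ?_⟩
        have := hfar u
        rw [SimpleGraph.dist_comm] at this
        omega)
      omega
    obtain ⟨w, hw⟩ := hbig
    obtain ⟨S, hne, hS⟩ := core_exists G a hlt
    obtain ⟨x, p, hp, hpl⟩ := long_path G hG a S hne hS w
    refine broom_embed G a p hp hpl ((Finset.univ.filter (fun y => G.Adj w y)) \
      ((Finset.range (a+1)).image p.getVert)) ?_ ?_ ?_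
    · have h1 := Finset.le_card_sdiff ((Finset.range (a+1)).image p.getVert)
        (Finset.univ.filter (fun y => G.Adj w y))
      have h2 := Finset.card_image_le (s := Finset.range (a+1)) (f := p.getVert)
      rw [Finset.card_range] at h2
      omega
    · intro u hu
      simp at hu
      exact hu.1
    · intro u hu i hi
      simp only [Finset.mem_sdiff, Finset.mem_image, Finset.mem_range, not_exists, not_and] at hu
      exact hu.2 i (by omega)

theorem broom_exConn (a n : ℕ) (hn : (3 * a + 1) ^ a < n) : exConn n (broom a) ≤ a * n := by
  apply csSup_le'
  rintro m ⟨G, hG, hfree, rfl⟩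
  simpa using broom_upper G hG a (by simpa using hn) hfree

open Classical in
theorem tree_embed {β : Type*} (G : SimpleGraph β) (S : Finset β) (hne : S.Nonempty) (K : ℕ)
    (hS : ∀ v ∈ S, K + 1 ≤ (S.filter (fun y => G.Adj v y)).card) :
    ∀ k ≤ K + 1, ∀ (V : Type) [Fintype V] (T : SimpleGraph V), Fintype.card V = k → T.IsTree →
      ∃ f : V ↪ β, (∀ v, f v ∈ S) ∧ ∀ ⦃a b⦄, T.Adj a b → G.Adj (f a) (f b) := by
  intro k
  induction k with
  | zero =>
    intro _ V _ T hc hT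
    have := hT.1.nonempty
    rw [Fintype.card_eq_zero_iff] at hc
    exact absurd hc (by simpa using this)
  | succ k ih =>
    intro hk V _ T hc hT
    rcases Nat.eq_zero_or_pos k with h0 | hpos
    · subst h0
      have hsub : Subsingleton V := Fintype.card_le_one_iff_subsingleton.mp (by omega)
      obtain ⟨s, hs⟩ := hne
      refine ⟨⟨fun _ => s, fun x y _ => Subsingleton.elim x y⟩, fun _ => hs, fun a b hab => ?_⟩
      exact absurd (Subsingleton.elim a b) hab.ne
    · have hnt : Nontrivial V := Fintype.one_lt_card_iff_nontrivial.mp (by omega)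
      obtain ⟨v, hv⟩ := hT.exists_vert_degree_one_of_nontrivial
      have hconn := hT.1.induce_compl_singleton_of_degree_eq_one hv
      have hac := hT.2.induce ({v}ᶜ : Set V)
      obtain ⟨u, hu, huniq⟩ := SimpleGraph.degree_eq_one_iff_existsUnique_adj.mp hv
      obtain ⟨f, hfS, hf⟩ := ih (by omega) (({v}ᶜ : Set V) : Type) (T.induce ({v}ᶜ : Set V))
        (by rw [Fintype.card_compl_set]; simp [hc]) ⟨hconn, hac⟩
      have huv : u ∈ ({v}ᶜ : Set V) := by simpa using hu.ne'
      have hlt : (Finset.univ.image f).card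
          < (S.filter (fun y => G.Adj (f ⟨u, huv⟩) y)).card := by
        have h1 := hS _ (hfS ⟨u, huv⟩)
        have h2 := Finset.card_image_le (s := (Finset.univ : Finset (({v}ᶜ : Set V) : Type))) (f := f)
        rw [Finset.card_univ, Fintype.card_compl_set] at h2
        simp [hc] at h2
        omega
      obtain ⟨y, hy, hny⟩ := Finset.exists_mem_notMem_of_card_lt_card hlt
      rw [Finset.mem_filter] at hy
      simp only [Finset.mem_image, Finset.mem_univ, true_and, not_exists] at hny
      let g : V → β := fun x => if h : x = v then y else f ⟨x, h⟩
      have hgv : g v = y := dif_pos rfl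
      have hgn : ∀ x (h : x ≠ v), g x = f ⟨x, h⟩ := fun x h => dif_neg h
      refine ⟨⟨g, ?_⟩, ?_, ?_⟩
      · intro a b hab
        by_cases ha : a = v <;> by_cases hb : b = v
        · rw [ha, hb]
        · rw [ha, hgv, hgn b hb] at hab
          exact absurd hab.symm (hny _)
        · rw [hb, hgv, hgn a ha] at hab
          exact absurd hab (hny _)
        · rw [hgn a ha, hgn b hb] at hab
          exact congrArg Subtype.val (f.injective hab)
      · intro a
        change g a ∈ S
        by_cases ha : a = v
        · rw [ha, hgv]; exact hy.1
        · rw [hgn a ha]; exact hfS _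
      · intro a b hab
        change G.Adj (g a) (g b)
        by_cases ha : a = v
        · subst ha
          have hb : b = u := huniq b hab
          subst hb
          rw [hgv, hgn b huv]
          exact hy.2.symm
        · by_cases hb : b = v
          · subst hb
            have ha' : a = u := huniq a hab.symm
            subst ha'
            rw [hgv, hgn a huv]
            exact hy.2
          · rw [hgn a ha, hgn b hb]
            exact hf (by simpa using hab)

theorem exConn_le {k : ℕ} (T : SimpleGraph (Fin k)) (hT : T.IsTree) (n : ℕ) :
    exConn n T ≤ k * n := by
  classical
  apply csSup_le'
  rintro m ⟨G, hG, hfree, rfl⟩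
  by_contra hlt
  push Not at hlt
  obtain ⟨S, hne, hS⟩ := core_exists G k (by simpa using hlt)
  obtain ⟨f, -, hf⟩ := tree_embed G S hne k (by convert hS) k (by omega) (Fin k) T (by simp) hT
  exact hfree ⟨f, hf⟩

theorem le_exConn {W α : Type*} [Fintype W] (F : SimpleGraph α) (G : SimpleGraph W) {n : ℕ}
    (hn : Fintype.card W = n) (hG : G.Connected) (hfree : ¬ ContainsCopy F G) :
    G.edgeSet.ncard ≤ exConn n F := by
  have e := G.overFinIso hn
  apply le_csSup
  · refine ⟨Nat.card (Sym2 (Fin n)), ?_⟩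
    rintro m ⟨H, -, -, rfl⟩
    exact Set.ncard_le_card _
  · refine ⟨G.overFin hn, e.connected_iff.mp hG, ?_, ?_⟩
    · rintro ⟨f, hf⟩
      exact hfree ⟨f.trans e.symm.toEquiv.toEmbedding, fun a b hab =>
        e.symm.map_rel_iff.mpr (hf hab)⟩
    · rw [← Nat.card_coe_set_eq, ← Nat.card_coe_set_eq]
      exact Nat.card_congr e.mapEdgeSet

/-- center plus `t` cliques of size `m` -/
def starG (t m : ℕ) : SimpleGraph (Option (Fin t × Fin m)) :=
  SimpleGraph.fromRel (fun a b => match a, b with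
    | some p, some q => p.1 = q.1
    | none, some q => q.2.val = 0
    | _, none => False)

/-- chain of `t` cliques of size `m` -/
def chainG (t m : ℕ) : SimpleGraph (Fin t × Fin m) :=
  SimpleGraph.fromRel (fun p q => p.1 = q.1 ∨ (p.1.val + 1 = q.1.val ∧ p.2.val = 0 ∧ q.2.val = 0))

theorem starG_same {t m : ℕ} {i : Fin t} {x y : Fin m} (h : x ≠ y) :
    (starG t m).Adj (some (i, x)) (some (i, y)) := by
  simp [starG, h]

theorem starG_none {t m : ℕ} {i : Fin t} {x : Fin m} (h : x.val = 0) :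
    (starG t m).Adj none (some (i, x)) := by
  simp [starG, h]

theorem starG_block {t m : ℕ} {p q : Fin t × Fin m} (h : (starG t m).Adj (some p) (some q)) :
    p.1 = q.1 := by
  simp [starG] at h
  rcases h.2 with h | h
  · exact h
  · exact h.symm

theorem chainG_same {t m : ℕ} {i : Fin t} {x y : Fin m} (h : x ≠ y) :
    (chainG t m).Adj (i, x) (i, y) := by
  simp [chainG, h]

theorem chainG_adj {t m : ℕ} {p q : Fin t × Fin m} (h : (chainG t m).Adj p q) :
    p.1 = q.1 ∨ (p.1.val + 1 = q.1.val ∧ p.2.val = 0 ∧ q.2.val = 0)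
      ∨ (q.1.val + 1 = p.1.val ∧ p.2.val = 0 ∧ q.2.val = 0) := by
  rw [chainG, SimpleGraph.fromRel_adj] at h
  rcases h.2 with (h | h) | (h | h)
  · exact Or.inl h
  · exact Or.inr (Or.inl h)
  · exact Or.inl h.symm
  · exact Or.inr (Or.inr ⟨h.1, h.2.2, h.2.1⟩)

theorem starG_connected {t m : ℕ} (hm : 0 < m) : (starG t m).Connected := by
  have key : ∀ a, (starG t m).Reachable a none := by
    rintro (_ | ⟨i, x⟩)
    · exact SimpleGraph.Reachable.refl _
    · have h0 : (starG t m).Reachable (some (i, ⟨0, hm⟩)) none :=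
        (starG_none (x := ⟨0, hm⟩) rfl).symm.reachable
      by_cases hx : x = ⟨0, hm⟩
      · rw [hx]; exact h0
      · exact (starG_same hx).reachable.trans h0
  rw [SimpleGraph.connected_iff]
  exact ⟨fun i j => (key i).trans (key j).symm, ⟨none⟩⟩

theorem chainG_connected {t m : ℕ} (hm : 0 < m) (ht : 0 < t) : (chainG t m).Connected := by
  have key1 : ∀ n (hn : n < t), (chainG t m).Reachable (⟨n, hn⟩, ⟨0, hm⟩) (⟨0, ht⟩, ⟨0, hm⟩) := by
    intro n
    induction n with
    | zero => intro hn; exact SimpleGraph.Reachable.refl _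
    | succ n ih =>
      intro hn
      refine SimpleGraph.Reachable.trans (SimpleGraph.Adj.reachable ?_) (ih (by omega))
      simp [chainG]
  have key : ∀ a, (chainG t m).Reachable a (⟨0, ht⟩, ⟨0, hm⟩) := by
    rintro ⟨i, x⟩
    by_cases hx : x = ⟨0, hm⟩
    · rw [hx]; exact key1 i.val i.2
    · exact (chainG_same hx).reachable.trans (key1 i.val i.2)
  rw [SimpleGraph.connected_iff]
  exact ⟨fun i j => (key i).trans (key j).symm, ⟨(⟨0, ht⟩, ⟨0, hm⟩)⟩⟩

open Classical in
theorem edges_lower {W : Type*} [Fintype W] (G : SimpleGraph W) {t m : ℕ}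
    (g : Fin t × Fin m ↪ W) (hg : ∀ i x y, x ≠ y → G.Adj (g (i, x)) (g (i, y))) :
    t * m * (m - 1) ≤ 2 * G.edgeSet.ncard := by
  rw [← two_mul_edges]
  have h1 : ∑ p : Fin t × Fin m, (Finset.univ.filter (fun y => G.Adj (g p) y)).card
      ≤ ∑ v, (Finset.univ.filter (fun y => G.Adj v y)).card := by
    rw [← Finset.sum_map Finset.univ g (fun v => (Finset.univ.filter (fun y => G.Adj v y)).card)]
    exact Finset.sum_le_sum_of_subset (Finset.subset_univ _)
  refine le_trans ?_ h1
  have h2 : ∑ p : Fin t × Fin m, (m - 1)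
      ≤ ∑ p : Fin t × Fin m, (Finset.univ.filter (fun y => G.Adj (g p) y)).card := by
    apply Finset.sum_le_sum
    rintro ⟨i, x⟩ _
    have h3 : ((Finset.univ.erase x).image (fun y => g (i, y))).card = m - 1 := by
      rw [Finset.card_image_of_injective _ (fun y z h => by simpa using h)]
      simp
    rw [← h3]
    apply Finset.card_le_card
    intro z hz
    simp at hz
    obtain ⟨y, hy, rfl⟩ := hz
    simp
    exact hg i x y (Ne.symm hy)
  simpa using h2

theorem ncard_le_block {V W : Type*} {m : ℕ} (f : V ↪ W) (S : Set V) (g : Fin m → W)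
    (h : ∀ v ∈ S, f v ∈ Set.range g) : S.ncard ≤ m := by
  have h1 : (f '' S).ncard = S.ncard := Set.ncard_image_of_injective _ f.injective
  have h2 : (f '' S).ncard ≤ (Set.range g).ncard :=
    Set.ncard_le_ncard (by rintro _ ⟨v, hv, rfl⟩; exact h v hv) (Set.finite_range g)
  have h3 : (Set.range g).ncard ≤ m := by
    rw [← Set.image_univ]
    exact (Set.ncard_image_le (Set.toFinite _)).trans (by simp [Set.ncard_univ])
  omega

theorem star_free {k t m : ℕ} (T : SimpleGraph (Fin k)) (hT : T.Connected) (hm : m < k)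
    (hbad : ∀ v, ∃ S : Set (Fin k), v ∉ S ∧ (T.induce S).Preconnected ∧ m < S.ncard) :
    ¬ ContainsCopy T (starG t m) := by
  rintro ⟨f, hf⟩
  have key : ∀ S : Set (Fin k), (T.induce S).Preconnected → (∀ v ∈ S, f v ≠ none) → S.ncard ≤ m := by
    intro S hS hno
    rcases S.eq_empty_or_nonempty with rfl | ⟨v, hv⟩
    · simp
    obtain ⟨p, hp⟩ := Option.ne_none_iff_exists'.mp (hno v hv)
    apply ncard_le_block f S (fun x => some (p.1, x))
    have walk : ∀ (a b : S) (w : (T.induce S).Walk a b), ∀ q, f b = some q →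
        ∃ x, f a = some (q.1, x) := by
      intro a b w
      induction w with
      | nil => intro q hq; exact ⟨q.2, hq⟩
      | cons h w ih =>
        intro q hq
        obtain ⟨x, hx⟩ := ih q hq
        rename_i c d e
        obtain ⟨r, hr⟩ := Option.ne_none_iff_exists'.mp (hno c c.2)
        have hadj := hf (SimpleGraph.induce_adj.mp h)
        rw [hr, hx] at hadj
        have := starG_block hadj
        exact ⟨r.2, by rw [hr, ← this]⟩
    intro u hu
    obtain ⟨w⟩ := hS ⟨u, hu⟩ ⟨v, hv⟩
    obtain ⟨x, hx⟩ := walk _ _ w p hp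
    exact ⟨x, hx.symm⟩
  by_cases h : ∃ v, f v = none
  · obtain ⟨v, hv⟩ := h
    obtain ⟨S, hvS, hS, hlt⟩ := hbad v
    have := key S hS (fun u hu h => hvS (by
      have : u = v := f.injective (h.trans hv.symm)
      rwa [← this]))
    omega
  · push Not at h
    have := key Set.univ (by
      have := (SimpleGraph.induceUnivIso T).symm.connected_iff.mp hT
      exact this.preconnected) (fun v _ => h v)
    simp [Set.ncard_univ] at this
    omega

theorem induce_preconn {V : Type*} (T : SimpleGraph V) (hT : T.Connected) (S : Set V) (v : V)
    (hv : v ∉ S) (huniq : ∀ x ∈ S, ∀ x' ∈ S, ∀ y ∉ S, ∀ y' ∉ S, T.Adj x y → T.Adj x' y' → x = x') :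
    (T.induce S).Preconnected := by
  have walk : ∀ (u z : V) (p : T.Walk u z), z ∉ S → ∀ hu : u ∈ S, ∃ x : S, (∃ y ∉ S, T.Adj x y) ∧
      (T.induce S).Reachable ⟨u, hu⟩ x := by
    intro u z p
    induction p with
    | nil => intro h1 h2; exact absurd h2 h1
    | cons h q ih =>
      rename_i a b c
      intro hz hu
      by_cases hb : b ∈ S
      · obtain ⟨x, hx, hr⟩ := ih hz hb
        refine ⟨x, hx, SimpleGraph.Reachable.trans (SimpleGraph.Adj.reachable ?_) hr⟩
        simpa using h
      · exact ⟨⟨a, hu⟩, ⟨b, hb, h⟩, SimpleGraph.Reachable.refl _⟩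
  rintro ⟨a, ha⟩ ⟨b, hb⟩
  obtain ⟨p⟩ := hT.preconnected a v
  obtain ⟨q⟩ := hT.preconnected b v
  obtain ⟨x, ⟨y, hy, hxy⟩, hx⟩ := walk _ _ p hv ha
  obtain ⟨x', ⟨y', hy', hxy'⟩, hx'⟩ := walk _ _ q hv hb
  have : x = x' := Subtype.ext (huniq x x.2 x' x'.2 y hy y' hy' hxy hxy')
  subst this
  exact hx.trans hx'.symm

theorem chain_free {k t m : ℕ} (T : SimpleGraph (Fin k)) (hT : T.Connected) (hm : 3 * m < k)
    (v : Fin k) (hgood : ∀ S : Set (Fin k), v ∉ S → (T.induce S).Preconnected → S.ncard ≤ m) :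
    ¬ ContainsCopy T (chainG t m) := by
  rintro ⟨f, hf⟩
  let i := (f v).1
  let R : Set (Fin k) := {u | i < (f u).1}
  let L : Set (Fin k) := {u | (f u).1 < i}
  let M : Set (Fin k) := {u | (f u).1 = i}
  have hM : M.ncard ≤ m := by
    apply ncard_le_block f M (fun x => (i, x))
    intro u hu
    exact ⟨(f u).2, by rw [← show (f u).1 = i from hu]⟩
  have hR : R.ncard ≤ m := by
    apply hgood R (by simp [R, i])
    apply induce_preconn T hT R v (by simp [R, i])
    intro x hx x' hx' y hy y' hy' hxy hxy'
    have h1 := chainG_adj (hf hxy)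
    have h2 := chainG_adj (hf hxy')
    simp only [R, Set.mem_setOf_eq, Fin.lt_def, Fin.ext_iff] at hx hx' hy hy' h1 h2
    apply f.injective
    apply Prod.ext <;> apply Fin.ext <;> omega
  have hL : L.ncard ≤ m := by
    apply hgood L (by simp [L, i])
    apply induce_preconn T hT L v (by simp [L, i])
    intro x hx x' hx' y hy y' hy' hxy hxy'
    have h1 := chainG_adj (hf hxy)
    have h2 := chainG_adj (hf hxy')
    simp only [L, Set.mem_setOf_eq, Fin.lt_def, Fin.ext_iff] at hx hx' hy hy' h1 h2
    apply f.injective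
    apply Prod.ext <;> apply Fin.ext <;> omega
  have hU : (Set.univ : Set (Fin k)) = (L ∪ M) ∪ R := by
    ext u
    simp only [Set.mem_univ, L, M, R, Set.mem_union, Set.mem_setOf_eq, true_iff]
    rcases lt_trichotomy (f u).1 i with h | h | h <;> simp [h]
  have h1 := Set.ncard_union_le (L ∪ M) R
  have h2 := Set.ncard_union_le L M
  rw [← hU, Set.ncard_univ, Nat.card_eq_fintype_card, Fintype.card_fin] at h1
  omega

theorem exConn_ge {k m : ℕ} (T : SimpleGraph (Fin k)) (hT : T.IsTree) (hm2 : 2 ≤ m)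
    (hm : 3 * m < k) (N : ℕ) : ∃ n ≥ N, 0 < n ∧ (m - 2) * n ≤ 2 * exConn n T := by
  obtain ⟨c, rfl⟩ : ∃ c, m = c + 2 := ⟨m - 2, by omega⟩
  by_cases hgood : ∃ v, ∀ S : Set (Fin k), v ∉ S → (T.induce S).Preconnected → S.ncard ≤ c + 2
  · obtain ⟨v, hv⟩ := hgood
    refine ⟨(N + 1) * (c + 2), by nlinarith, by positivity, ?_⟩
    have h1 := le_exConn (n := (N+1)*(c+2)) T (chainG (N+1) (c+2)) (by simp)
      (chainG_connected (by omega) (by omega)) (chain_free T hT.1 hm v hv)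
    have h2 := edges_lower (chainG (N+1) (c+2)) (Function.Embedding.refl _)
      (fun i x y h => chainG_same h)
    simp only [Nat.add_sub_cancel, show c + 2 - 1 = c + 1 by omega] at *
    nlinarith
  · push Not at hgood
    refine ⟨(N + 1) * (c + 2) + 1, by nlinarith, by positivity, ?_⟩
    have h1 := le_exConn (n := (N+1)*(c+2) + 1) T (starG (N+1) (c+2)) (by simp)
      (starG_connected (by omega)) (star_free T hT.1 (by omega) hgood)
    have h2 := edges_lower (starG (N+1) (c+2)) Function.Embedding.some
      (fun i x y h => starG_same h)
    simp only [Nat.add_sub_cancel, show c + 2 - 1 = c + 1 by omega] at *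
    nlinarith

theorem gamma_bdd {k : ℕ} (hk : 2 < k) (T : SimpleGraph (Fin k)) (hT : T.IsTree) (n : ℕ) :
    2 / ((Fintype.card (Fin k) : ℝ) - 2) * ((exConn n T : ℝ) / (n : ℝ)) ≤ 2 / ((k : ℝ) - 2) * k := by
  rw [Fintype.card_fin]
  have hk' : (2 : ℝ) < k := by exact_mod_cast hk
  have h0 : 0 ≤ 2 / ((k : ℝ) - 2) := div_nonneg (by norm_num) (by linarith)
  apply mul_le_mul_of_nonneg_left _ h0
  have h1 : (exConn n T : ℝ) ≤ k * n := by exact_mod_cast exConn_le T hT n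
  exact div_le_of_le_mul₀ (by positivity) (by positivity) h1

theorem gamma_nonneg_term {k : ℕ} (hk : 2 < k) (T : SimpleGraph (Fin k)) (n : ℕ) :
    0 ≤ 2 / ((Fintype.card (Fin k) : ℝ) - 2) * ((exConn n T : ℝ) / (n : ℝ)) := by
  rw [Fintype.card_fin]
  have hk' : (2 : ℝ) < k := by exact_mod_cast hk
  have h0 : 0 ≤ 2 / ((k : ℝ) - 2) := div_nonneg (by norm_num) (by linarith)
  positivity

theorem gammaTree_ge {k : ℕ} (hk : 9 < k) (T : SimpleGraph (Fin k)) (hT : T.IsTree) :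
    1 / 3 - 3 / ((k : ℝ) - 2) ≤ gammaTree T := by
  have hk' : (9 : ℝ) < k := by exact_mod_cast hk
  unfold gammaTree
  apply Filter.le_limsup_of_frequently_le
  · rw [Filter.frequently_atTop]
    intro N
    obtain ⟨n, hn, hn0, h⟩ := exConn_ge (m := (k - 1) / 3) T hT (by omega) (by omega) N
    refine ⟨n, hn, ?_⟩
    rw [Fintype.card_fin]
    obtain ⟨c, hc⟩ : ∃ c, (k - 1) / 3 - 2 = c := ⟨_, rfl⟩
    rw [hc] at h
    have hck : k ≤ 3 * c + 9 := by omega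
    have hck' : (k : ℝ) ≤ 3 * c + 9 := by exact_mod_cast hck
    have h' : (c : ℝ) * n ≤ 2 * exConn n T := by exact_mod_cast h
    have hn' : (0 : ℝ) < n := by exact_mod_cast hn0
    have h1 : (c : ℝ) / 2 ≤ exConn n T / n := by
      rw [div_le_div_iff₀ (by norm_num) hn']; linarith
    have h2 : 0 ≤ 2 / ((k : ℝ) - 2) := div_nonneg (by norm_num) (by linarith)
    refine le_trans ?_ (mul_le_mul_of_nonneg_left h1 h2)
    have h3 : (k : ℝ) - 2 ≠ 0 := by linarith
    have h4 : 0 < (k : ℝ) - 2 := by linarith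
    rw [show 1 / 3 - 3 / ((k : ℝ) - 2) = ((k - 2) / 3 - 3) / (k - 2) by field_simp,
      show 2 / ((k : ℝ) - 2) * (c / 2) = c / (k - 2) by field_simp]
    apply div_le_div_of_nonneg_right _ h4.le
    linarith
  · exact ⟨_, Filter.eventually_map.mpr (Filter.Eventually.of_forall (gamma_bdd (by omega) T hT))⟩

theorem gammaTree_broom_le {a : ℕ} (ha : 1 < a) :
    gammaTree (broom a) ≤ 2 / 3 + 1 / (3 * (a : ℝ) - 1) := by
  have ha' : (1 : ℝ) < a := by exact_mod_cast ha
  unfold gammaTree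
  apply Filter.limsup_le_of_le
  · refine Filter.IsBoundedUnder.isCoboundedUnder_le ?_
    exact ⟨0, Filter.eventually_map.mpr (Filter.Eventually.of_forall
      (gamma_nonneg_term (by omega) (broom a)))⟩
  · filter_upwards [Filter.eventually_gt_atTop ((3 * a + 1) ^ a)] with n hn
    rw [Fintype.card_fin]
    push_cast
    have h1 : (exConn n (broom a) : ℝ) ≤ a * n := by exact_mod_cast broom_exConn a n hn
    have h2 : (exConn n (broom a) : ℝ) / n ≤ a :=
      div_le_of_le_mul₀ (by positivity) (by positivity) h1
    have h3 : 0 < 3 * (a : ℝ) - 1 := by linarith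
    rw [show 3 * (a : ℝ) + 1 - 2 = 3 * a - 1 by ring]
    refine le_trans (mul_le_mul_of_nonneg_left h2 (by positivity)) ?_
    rw [show 2 / (3 * (a : ℝ) - 1) * a = 2 * a / (3 * a - 1) by ring,
      div_add_div _ _ (by norm_num) h3.ne', div_le_div_iff₀ h3 (by positivity)]
    nlinarith

theorem gammaInf_ge {k : ℕ} (hk : 9 < k) : 1 / 3 - 3 / ((k : ℝ) - 2) ≤ gammaInf k := by
  have hk' : (9 : ℝ) < k := by exact_mod_cast hk
  apply le_csInf
  · exact ⟨_, 3 * k + 1, by omega, broom k, broom_isTree k, rfl⟩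
  · rintro x ⟨m, hm, T, hT, rfl⟩
    have hm' : (k : ℝ) ≤ m := by exact_mod_cast hm
    refine le_trans ?_ (gammaTree_ge (by omega) T hT)
    have : 3 / ((m : ℝ) - 2) ≤ 3 / ((k : ℝ) - 2) :=
      div_le_div_of_nonneg_left (by norm_num) (by linarith) (by linarith)
    linarith

theorem gammaInf_le {k : ℕ} (hk : 9 < k) : gammaInf k ≤ 2 / 3 + 1 / (3 * (k : ℝ) - 1) := by
  refine le_trans (csInf_le ?_ ?_) (gammaTree_broom_le (a := k) (by omega))
  · refine ⟨0, ?_⟩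
    rintro x ⟨m, hm, T, hT, rfl⟩
    have hm' : (11 : ℝ) ≤ m ∨ m = 10 := by
      rcases Nat.lt_or_ge m 11 with h | h
      · right; omega
      · left; exact_mod_cast h
    refine Filter.le_limsup_of_frequently_le
      (Filter.Frequently.of_forall (gamma_nonneg_term (by omega) T)) ?_
    exact ⟨_, Filter.eventually_map.mpr (Filter.Eventually.of_forall (gamma_bdd (by omega) T hT))⟩
  · exact ⟨3 * k + 1, by omega, broom k, broom_isTree k, rfl⟩

/-- Theorem: `γ = lim_{k → ∞} γ_k` satisfies `1/3 ≤ γ ≤ 2/3`. -/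
theorem gamma_bounds (γ : ℝ)
    (hγ : Filter.Tendsto (fun k : ℕ => gammaInf k) Filter.atTop (nhds γ)) :
    1 / 3 ≤ γ ∧ γ ≤ 2 / 3 := by
  have hcast : Filter.Tendsto (fun k : ℕ => (k : ℝ)) Filter.atTop Filter.atTop :=
    tendsto_natCast_atTop_atTop
  constructor
  · have h1 : Filter.Tendsto (fun k : ℕ => 1 / 3 - 3 / ((k : ℝ) - 2)) Filter.atTop
        (nhds (1 / 3 - 0)) := by
      apply Filter.Tendsto.const_sub
      apply Filter.Tendsto.const_div_atTop
      exact Filter.tendsto_atTop_add_const_right _ _ hcast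
    rw [sub_zero] at h1
    refine le_of_tendsto_of_tendsto h1 hγ ?_
    filter_upwards [Filter.eventually_gt_atTop 9] with k hk
    exact gammaInf_ge hk
  · have h1 : Filter.Tendsto (fun k : ℕ => 2 / 3 + 1 / (3 * (k : ℝ) - 1)) Filter.atTop
        (nhds (2 / 3 + 0)) := by
      apply Filter.Tendsto.const_add
      apply Filter.Tendsto.const_div_atTop
      exact Filter.tendsto_atTop_add_const_right _ _ (hcast.const_mul_atTop (by norm_num))
    rw [add_zero] at h1
    refine le_of_tendsto_of_tendsto hγ h1 ?_
    filter_upwards [Filter.eventually_gt_atTop 9] with k hk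
    exact gammaInf_le hk
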